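/- Let G be a graph, x a cut-vertex of G, W the vertex set of a component of G − x, and suppose G[W ∪ {x}] is a tree. Then for any PSD fort F of G, if F ∩ (W ∪ {x}) ≠ ∅ then W ∪ {x} ⊆ F. -/

import Mathlib

/-- A standard fort: a nonempty set `F` such that no vertex outside `F` has exactly one
neighbor in `F`. -/
def stdFort {V : Type*} (G : SimpleGraph V) (F : Set V) : Prop :=
  F.Nonempty ∧ ∀ v ∉ F, (G.neighborSet v ∩ F).ncard ≠ 1

/-- The vertex set of the connected component of `u` in the subgraph induced by `F`. -/
def compOf {V : Type*} (G : SimpleGraph V) (F : Set V) (u : F) : Set V :=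
  {w | ∃ hw : w ∈ F, (G.induce F).Reachable ⟨w, hw⟩ u}

/-- A PSD fort: a nonempty set each of whose induced connected components is a standard
fort of `G`. -/
def psdFort {V : Type*} (G : SimpleGraph V) (F : Set V) : Prop :=
  F.Nonempty ∧ ∀ u : F, stdFort G (compOf G F u)

/-- `S` is PSD-irredundant if every element of `S` has a private PSD fort. -/
def psdIrr {V : Type*} (G : SimpleGraph V) (S : Set V) : Prop :=
  ∀ u ∈ S, ∃ F : Set V, psdFort G F ∧ S ∩ F = {u}

/-- Let every edge leaving `T` leave it at `x`, and let `v` lie in `T` but not in `F`. If `y` is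
reachable inside `F` from a vertex `a` of `T`, then `y` (or `x`, if `y` is outside `T`) is reachable
from `a` in `G[T]` without using the edge `va`. -/
theorem reachable_deleteEdge_of_reachable_induce {V : Type*} {G : SimpleGraph V} {x : V}
    {T F : Set V}
    (hx : x ∈ T) (hT : ∀ w ∈ T, ∀ u ∉ T, G.Adj w u → w = x)
    {v a : V} (hvT : v ∈ T) (haT : a ∈ T) (hvF : v ∉ F) (haF : a ∈ F)
    (y : F) (hy : (G.induce F).Reachable ⟨a, haF⟩ y) :
    (∀ h : y.1 ∈ T, ((G.induce T).deleteEdges {s(⟨v, hvT⟩, ⟨a, haT⟩)}).Reachable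
      ⟨a, haT⟩ ⟨y.1, h⟩) ∧
    (y.1 ∉ T → x ≠ v ∧ ((G.induce T).deleteEdges {s(⟨v, hvT⟩, ⟨a, haT⟩)}).Reachable
      ⟨a, haT⟩ ⟨x, hx⟩) := by
  rw [SimpleGraph.reachable_iff_reflTransGen] at hy
  induction hy with
  | refl => exact ⟨fun _ => .refl _, fun h => absurd haT h⟩
  | @tail y z _ hyz ih =>
    obtain ⟨y, hyF⟩ := y
    obtain ⟨z, hzF⟩ := z
    have hadj : G.Adj y z := hyz
    have hyv : y ≠ v := fun h => hvF (h ▸ hyF)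
    have hzv : z ≠ v := fun h => hvF (h ▸ hzF)
    by_cases hyT : y ∈ T
    · refine ⟨fun hzT => (ih.1 hyT).trans (SimpleGraph.Adj.reachable ?_), fun hzT => ?_⟩
      · simp [hadj, hyv, hzv]
      · obtain rfl := hT y hyT z hzT hadj
        exact ⟨hyv, ih.1 hyT⟩
    · refine ⟨fun hzT => ?_, fun _ => ih.2 hyT⟩
      obtain rfl := hT z hzT y hyT hadj.symm
      exact (ih.2 hyT).2

/-- A PSD fort that contains a vertex `a` of an acyclic `G[T]` attached to the rest of `G` only
at `x` contains every neighbor of `a` in `T`. -/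
theorem psdFort_mem_of_adj {V : Type*} {G : SimpleGraph V} {x : V} {T F : Set V}
    (hx : x ∈ T) (hT : ∀ w ∈ T, ∀ u ∉ T, G.Adj w u → w = x)
    (hacyc : (G.induce T).IsAcyclic) (hF : psdFort G F)
    {a v : V} (haT : a ∈ T) (hvT : v ∈ T) (hadj : G.Adj a v) (haF : a ∈ F) : v ∈ F := by
  by_contra hvF
  have hbridge : (G.induce T).IsBridge s(⟨v, hvT⟩, ⟨a, haT⟩) :=
    SimpleGraph.isAcyclic_iff_forall_isBridge.1 hacyc hadj.symm
  have hvC : v ∉ compOf G F ⟨a, haF⟩ := fun h => hvF h.1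
  apply (hF.2 ⟨a, haF⟩).2 v hvC
  rw [Set.ncard_eq_one]
  refine ⟨a, Set.eq_singleton_iff_unique_mem.2 ⟨⟨hadj.symm, haF, .refl _⟩, ?_⟩⟩
  rintro b ⟨hvb, hbF, hb⟩
  by_contra hba
  replace hvb : G.Adj v b := hvb
  have key := reachable_deleteEdge_of_reachable_induce hx hT hvT haT hvF haF ⟨b, hbF⟩ hb.symm
  have hbT : b ∈ T := by
    by_contra hbT
    exact (key.2 hbT).1 (hT v hvT b hbT hvb).symm
  refine SimpleGraph.isBridge_iff.1 hbridge (.symm ((key.1 hbT).trans (.symm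
    (SimpleGraph.Adj.reachable ?_))))
  simp [hvb, hba, hvb.ne']

/-- If `x` is a cut-vertex, `W` is the vertex set of a component of `G − x`, and
`G[W ∪ {x}]` is a tree, then any PSD fort meeting `W ∪ {x}` contains all of `W ∪ {x}`. -/
theorem stmt14 {V : Type*} [Fintype V] (G : SimpleGraph V) (x : V) (W : Set V)
    (hcut : Nat.card G.ConnectedComponent <
      Nat.card (G.induce ({x}ᶜ : Set V)).ConnectedComponent)
    (hxW : x ∉ W)
    (hWconn : (G.induce W).Connected)
    (hWmax : ∀ w ∈ W, ∀ u : V, G.Adj w u → u = x ∨ u ∈ W)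
    (htree : (G.induce (insert x W)).IsTree) :
    ∀ F : Set V, psdFort G F → (F ∩ insert x W).Nonempty → insert x W ⊆ F := by
  rintro F hF ⟨a, haF, haT⟩ v hvT
  have hT : ∀ w ∈ insert x W, ∀ u ∉ insert x W, G.Adj w u → w = x := fun w hw u hu h =>
    hw.resolve_right fun hw => hu (hWmax w hw u h)
  have hreach := htree.1.preconnected ⟨a, haT⟩ ⟨v, hvT⟩
  rw [SimpleGraph.reachable_iff_reflTransGen] at hreach
  suffices ∀ w : (insert x W : Set V), Relation.ReflTransGen (G.induce (insert x W)).Adj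
      ⟨a, haT⟩ w → w.1 ∈ F from this _ hreach
  intro w hw
  induction hw with
  | refl => exact haF
  | @tail y z _ hyz ih =>
    exact psdFort_mem_of_adj (Set.mem_insert x W) hT htree.2 hF y.2 z.2 hyz ih
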